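/- Let ω be a weight on ℝ₊, let h : ℝ₊ → [0,∞) be measurable with h(t) > 0 for almost every t, and let 1 < p, q < ∞. Suppose the Hardy operator Hv(t) := ∫_0^t v(s) ds is bounded from L^p(ℝ₊,ω) to L^q(ℝ₊,h), i.e. there is C > 0 such that (∫_0^∞ (∫_0^t |v(s)| ds)^q h(t) dt)^{1/q} ≤ C (∫_0^∞ |v(t)|^p ω(t) dt)^{1/p} for all v ∈ L^p(ℝ₊,ω). Then: (i) ω ∈ B_p(0) and ∫_1^∞ h(t) dt < ∞; (ii) for every u ∈ D^{1,p}(ℝ₊,ω) with lim_{t→0⁺} u(t) = 0 one has (∫_0^∞ |u(t)|^q h(t) dt)^{1/q} ≤ C (∫_0^∞ |u'(t)|^p ω(t) dt)^{1/p}; and (iii) if in addition ∫_0^1 h(t) dt = ∞, then for every u ∈ D^{1,p}(ℝ₊,ω) with lim_{t→0⁺} u(t) ≠ 0 one has ∫_0^∞ |u(t)|^q h(t) dt = ∞, so the Hardy-type inequality in (ii) holds (with finite left-hand side) precisely on R^0_{p,ω}(0). -/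

import Mathlib

open MeasureTheory Set Filter Topology
open scoped NNReal ENNReal

noncomputable section

/-- A weight on `ℝ₊ = (0,∞)`: continuous and positive there. -/
def IsWeight (ω : ℝ → ℝ) : Prop :=
  ContinuousOn ω (Set.Ioi 0) ∧ ∀ t : ℝ, 0 < t → 0 < ω t

/-- Membership of the pair `(u, u')` in the weighted Dirichlet space
`D^{1,p}(ℝ₊, ω)`: `u'` is locally integrable on `(0,∞)`, `u` is locally
absolutely continuous with derivative `u'`, and `∫_0^∞ |u'|^p ω < ∞`. -/
def MemD (p : ℝ) (ω u u' : ℝ → ℝ) : Prop :=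
  (∀ a b : ℝ, 0 < a → a < b → IntegrableOn u' (Set.Ioc a b)) ∧
  (∀ a b : ℝ, 0 < a → a < b → u b - u a = ∫ τ in a..b, u' τ) ∧
  IntegrableOn (fun t => |u' t| ^ p * ω t) (Set.Ioi 0)

/-- `‖u'‖_{L^p(ℝ₊, ω)} = (∫_0^∞ |u'(t)|^p ω(t) dt)^{1/p}`. -/
def dNorm (p : ℝ) (ω u' : ℝ → ℝ) : ℝ :=
  (∫ t in Set.Ioi (0:ℝ), |u' t| ^ p * ω t) ^ (1 / p)

/-- The norm `‖u‖^{(a)} = |u(a)| + ‖u'‖_{L^p(ℝ₊, ω)}`. -/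
def aNorm (p : ℝ) (ω : ℝ → ℝ) (a : ℝ) (u u' : ℝ → ℝ) : ℝ :=
  |u a| + dNorm p ω u'

/-- `ω ∈ B_p(0)`: `∫_0^1 ω(t)^{-1/(p-1)} dt < ∞`. -/
def Bp0 (p : ℝ) (ω : ℝ → ℝ) : Prop :=
  IntegrableOn (fun t => ω t ^ (-1 / (p - 1))) (Set.Ioc (0:ℝ) 1)

/-- `ω ∈ B_p(∞)`: `∫_1^∞ ω(t)^{-1/(p-1)} dt < ∞`. -/
def BpInf (p : ℝ) (ω : ℝ → ℝ) : Prop :=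
  IntegrableOn (fun t => ω t ^ (-1 / (p - 1))) (Set.Ioi (1:ℝ))

/-- `Ω^0_ω(t) = (∫_0^t ω(τ)^{-1/(p-1)} dτ)^{1-1/p}`. -/
def Omega0 (p : ℝ) (ω : ℝ → ℝ) (t : ℝ) : ℝ :=
  (∫ τ in Set.Ioc (0:ℝ) t, ω τ ^ (-1 / (p - 1))) ^ (1 - 1 / p)

/-- `Ω^∞_ω(t) = (∫_t^∞ ω(τ)^{-1/(p-1)} dτ)^{1-1/p}`. -/
def OmegaInf (p : ℝ) (ω : ℝ → ℝ) (t : ℝ) : ℝ :=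
  (∫ τ in Set.Ioi t, ω τ ^ (-1 / (p - 1))) ^ (1 - 1 / p)

/-- `R^0_{p,ω}(c)`: elements of `D^{1,p}(ℝ₊,ω)` with
`u(t) = c + ∫_0^t u'(τ) dτ` for every `t > 0`. -/
def MemR0 (p : ℝ) (ω : ℝ → ℝ) (c : ℝ) (u u' : ℝ → ℝ) : Prop :=
  MemD p ω u u' ∧ ∀ t : ℝ, 0 < t →
    IntegrableOn u' (Set.Ioc 0 t) ∧ u t = c + ∫ τ in Set.Ioc (0:ℝ) t, u' τ

/-- `R^∞_{p,ω}(c)`: elements of `D^{1,p}(ℝ₊,ω)` with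
`u(t) = c - ∫_t^∞ u'(τ) dτ` for every `t > 0`. -/
def MemRInf (p : ℝ) (ω : ℝ → ℝ) (c : ℝ) (u u' : ℝ → ℝ) : Prop :=
  MemD p ω u u' ∧ ∀ t : ℝ, 0 < t →
    IntegrableOn u' (Set.Ioi t) ∧ u t = c - ∫ τ in Set.Ioi t, u' τ

/-- `D_0^{1,p}(ℝ₊,ω)`: elements of `D^{1,p}(ℝ₊,ω)` approximable by smooth
compactly supported functions on `(0,∞)`, with derivatives converging in
`L^p(ℝ₊,ω)` and locally uniform convergence on compact subsets of `(0,∞)`. -/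
def MemD0 (p : ℝ) (ω u u' : ℝ → ℝ) : Prop :=
  MemD p ω u u' ∧
  ∃ φ : ℕ → ℝ → ℝ,
    (∀ n, ContDiff ℝ (⊤ : ℕ∞) (φ n) ∧ HasCompactSupport (φ n) ∧ tsupport (φ n) ⊆ Set.Ioi 0) ∧
    Tendsto (fun n => ∫ t in Set.Ioi (0:ℝ), |deriv (φ n) t - u' t| ^ p * ω t)
      atTop (𝓝 0) ∧
    (∀ K : Set ℝ, K ⊆ Set.Ioi 0 → IsCompact K →
      TendstoUniformlyOn (fun n => φ n) u atTop K)

/-- A weight raised to a real power, cut off to a compact subinterval of `(0,∞)`, is measurable. -/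
lemma IsWeight.measurable_indicator_rpow {ω : ℝ → ℝ} (hω : IsWeight ω) (r : ℝ) {ε a : ℝ}
    (hε : 0 < ε) : Measurable ((Ioc ε a).indicator fun t => ω t ^ r) := by
  have hc : ContinuousOn (fun t => ω t ^ r) (Ioi 0) :=
    hω.1.rpow_const fun x hx => Or.inl (hω.2 x hx).ne'
  have hc' : ContinuousOn (fun t => ω t ^ r) (Ioc ε a) :=
    hc.mono fun x hx => hε.trans hx.1
  classical
  rw [← piecewise_eq_indicator]
  exact hc'.measurable_piecewise continuousOn_const measurableSet_Ioc

lemma IsWeight.lintegral_rpow_lt_top {ω : ℝ → ℝ} (hω : IsWeight ω) (r : ℝ) {ε a : ℝ}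
    (hε : 0 < ε) : ∫⁻ t in Ioc ε a, ENNReal.ofReal (ω t ^ r) < ⊤ := by
  have hc : ContinuousOn (fun t => ω t ^ r) (Icc ε a) :=
    (hω.1.rpow_const fun x hx => Or.inl (hω.2 x hx).ne').mono fun x hx => hε.trans_le hx.1
  exact (hc.integrableOn_Icc.mono_set Ioc_subset_Icc_self).lintegral_lt_top

lemma IsWeight.lintegral_rpow_pos {ω : ℝ → ℝ} (hω : IsWeight ω) (r : ℝ) {ε a : ℝ}
    (hε : 0 < ε) (hεa : ε < a) : 0 < ∫⁻ t in Ioc ε a, ENNReal.ofReal (ω t ^ r) := by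
  have hpos : ∀ t ∈ Ioc ε a, 0 < ω t ^ r := fun t ht =>
    Real.rpow_pos_of_pos (hω.2 t (hε.trans ht.1)) r
  have hm := (hω.measurable_indicator_rpow r hε (a := a)).ennreal_ofReal
  rw [← setLIntegral_congr_fun measurableSet_Ioc
    (f := fun t => ENNReal.ofReal ((Ioc ε a).indicator (fun t => ω t ^ r) t))
    (fun t ht => by simp only [indicator_of_mem ht]),
    setLIntegral_pos_iff hm]
  have hsub : Ioc ε a ⊆ Function.support
      (fun t => ENNReal.ofReal ((Ioc ε a).indicator (fun t => ω t ^ r) t)) := fun t ht => by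
    simp only [Function.mem_support, indicator_of_mem ht]
    exact (ENNReal.ofReal_pos.2 (hpos t ht)).ne'
  rw [inter_eq_self_of_subset_right hsub]
  simpa using hεa

/-- Testing the Hardy inequality on `ω ^ (-1 / (p - 1))` restricted to `(ε, a]`. -/
lemma hardy_test {p q : ℝ} {ω h : ℝ → ℝ} (hp : 1 < p) (hq : 1 < q)
    (hω : IsWeight ω) (hmeas : Measurable h) {K : ℝ≥0∞}
    (hbound : ∀ v : ℝ → ℝ, Measurable v →
      (∫⁻ t in Ioi (0 : ℝ),
          (∫⁻ s in Ioc (0 : ℝ) t, ENNReal.ofReal |v s|) ^ q * ENNReal.ofReal (h t)) ^ (1 / q)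
        ≤ K * (∫⁻ t in Ioi (0 : ℝ),
            ENNReal.ofReal |v t| ^ p * ENNReal.ofReal (ω t)) ^ (1 / p))
    {ε a : ℝ} (hε : 0 < ε) (hεa : ε < a) :
    (∫⁻ t in Ioc ε a, ENNReal.ofReal (ω t ^ (-1 / (p - 1))))
        * (∫⁻ t in Ioi a, ENNReal.ofReal (h t)) ^ (1 / q)
      ≤ K * (∫⁻ t in Ioc ε a, ENNReal.ofReal (ω t ^ (-1 / (p - 1)))) ^ (1 / p) := by
  have hp1 : p - 1 ≠ 0 := by linarith
  have hp0 : 0 < p := by linarith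
  have hq0 : 0 < q := by linarith
  set r := -1 / (p - 1) with hr
  set A := ∫⁻ t in Ioc ε a, ENNReal.ofReal (ω t ^ r) with hA
  set v := (Ioc ε a).indicator fun t => ω t ^ r with hv
  have hpos : ∀ t ∈ Ioc ε a, 0 < ω t := fun t ht => hω.2 t (hε.trans ht.1)
  have habs : (fun t => ENNReal.ofReal |v t|)
      = (Ioc ε a).indicator fun t => ENNReal.ofReal (ω t ^ r) := by
    ext t
    by_cases ht : t ∈ Ioc ε a
    · simp [hv, ht, abs_of_pos (Real.rpow_pos_of_pos (hpos t ht) r)]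
    · simp [hv, ht]
  have hrhs : (fun t => ENNReal.ofReal |v t| ^ p * ENNReal.ofReal (ω t))
      = (Ioc ε a).indicator fun t => ENNReal.ofReal (ω t ^ r) := by
    ext t
    rw [congrFun habs t]
    by_cases ht : t ∈ Ioc ε a
    · have h0 := hpos t ht
      rw [indicator_of_mem ht,
        ENNReal.ofReal_rpow_of_nonneg (by positivity) hp0.le,
        ← ENNReal.ofReal_mul (by positivity), ← Real.rpow_mul h0.le]
      congr 1
      nth_rewrite 2 [← Real.rpow_one (ω t)]
      rw [← Real.rpow_add h0]
      congr 1
      rw [hr]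
      field_simp
      ring
    · simp [ht, hp0]
  have hsub : Ioc ε a ⊆ Ioi 0 := fun t ht => hε.trans ht.1
  have hB := hbound v (hω.measurable_indicator_rpow r hε)
  rw [hrhs, setLIntegral_indicator measurableSet_Ioc, inter_eq_self_of_subset_left hsub] at hB
  refine le_trans ?_ hB
  have hrw : A * (∫⁻ t in Ioi a, ENNReal.ofReal (h t)) ^ (1 / q)
      = (A ^ q * ∫⁻ t in Ioi a, ENNReal.ofReal (h t)) ^ (1 / q) := by
    rw [ENNReal.mul_rpow_of_nonneg _ _ (by positivity), ← ENNReal.rpow_mul,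
      mul_one_div_cancel hq0.ne', ENNReal.rpow_one]
  rw [hrw, ← lintegral_const_mul _ hmeas.ennreal_ofReal]
  refine ENNReal.rpow_le_rpow ?_ (by positivity)
  refine le_trans ?_ (lintegral_mono_set (Ioi_subset_Ioi (hε.trans hεa).le))
  refine setLIntegral_mono' measurableSet_Ioi fun t ht => ?_
  gcongr
  rw [habs, setLIntegral_indicator measurableSet_Ioc, inter_eq_self_of_subset_left]
  exact fun s hs => ⟨hε.trans hs.1, hs.2.trans (le_of_lt ht)⟩

/-- An absolutely continuous function vanishing at `0` is bounded by the integral of its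
derivative. -/
lemma MemD.ofReal_abs_le {p : ℝ} {ω u u' : ℝ → ℝ} (hu : MemD p ω u u')
    (h0 : Tendsto u (𝓝[>] 0) (𝓝 0)) {t : ℝ} (ht : 0 < t) :
    ENNReal.ofReal |u t| ≤ ∫⁻ s in Ioc 0 t, ENNReal.ofReal |u' s| := by
  have hlim : Tendsto (fun s => ENNReal.ofReal |u t - u s|) (𝓝[>] 0)
      (𝓝 (ENNReal.ofReal |u t|)) := by
    have : Tendsto (fun s => |u t - u s|) (𝓝[>] 0) (𝓝 |u t|) := by
      simpa using (tendsto_const_nhds.sub h0).abs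
    exact ENNReal.tendsto_ofReal this
  refine le_of_tendsto hlim ?_
  filter_upwards [Ioo_mem_nhdsGT ht] with s hs
  rw [hu.2.1 s t hs.1 hs.2, intervalIntegral.integral_of_le hs.2.le, ← Real.norm_eq_abs,
    ofReal_norm]
  refine (enorm_integral_le_lintegral_enorm _).trans ?_
  simp_rw [← ofReal_norm, Real.norm_eq_abs]
  exact lintegral_mono_set (Ioc_subset_Ioc_left hs.1.le)

lemma MemD.aemeasurable {p : ℝ} {ω u u' : ℝ → ℝ} (hu : MemD p ω u u') :
    AEMeasurable u' (volume.restrict (Ioi 0)) := by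
  have hU : Ioi (0 : ℝ) = ⋃ n : ℕ, Ioc (1 / ((n : ℝ) + 1)) ((n : ℝ) + 2) := by
    ext x
    simp only [mem_Ioi, mem_iUnion, mem_Ioc]
    refine ⟨fun hx => ?_, fun ⟨n, hn, _⟩ => lt_trans (by positivity) hn⟩
    obtain ⟨n, hn⟩ := exists_nat_one_div_lt hx
    obtain ⟨m, hm⟩ := exists_nat_ge x
    refine ⟨max n m, lt_of_le_of_lt ?_ hn, ?_⟩
    · gcongr
      exact_mod_cast le_max_left n m
    · have : (m : ℝ) ≤ ((max n m : ℕ) : ℝ) := by exact_mod_cast le_max_right n m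
      linarith
  rw [hU, aemeasurable_iUnion_iff]
  intro n
  refine (hu.1 _ _ (by positivity) ?_).1.aemeasurable
  have h1 : 1 / ((n : ℝ) + 1) ≤ 1 := by
    rw [div_le_one (by positivity)]
    linarith [n.cast_nonneg (α := ℝ)]
  linarith [n.cast_nonneg (α := ℝ)]

/-- analysis of the Hardy inequality: if the Hardy operator is
bounded from `L^p(ℝ₊,ω)` to `L^q(ℝ₊,h)` with constant `C`, then
(i) `ω ∈ B_p(0)` and `∫_1^∞ h < ∞`;
(ii) the Hardy inequality
`(∫_0^∞ |u|^q h)^{1/q} ≤ C (∫_0^∞ |u'|^p ω)^{1/p}` holds for every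
`u ∈ D^{1,p}(ℝ₊,ω)` with `lim_{t→0⁺} u(t) = 0`;
(iii) if moreover `∫_0^1 h = ∞`, then for every `u ∈ D^{1,p}(ℝ₊,ω)` with
`lim_{t→0⁺} u(t) = c ≠ 0` the left-hand side is infinite, so the inequality
holds with finite left-hand side precisely on `R^0_{p,ω}(0)`. -/
theorem stmt19 (p q : ℝ) (ω h : ℝ → ℝ) (hp : 1 < p) (hq : 1 < q)
    (hω : IsWeight ω) (hmeas : Measurable h) (hnn : ∀ t, 0 ≤ h t)
    (hpos : ∀ᵐ t ∂(volume.restrict (Set.Ioi (0:ℝ))), 0 < h t)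
    (C : ℝ) (hC : 0 < C)
    (hbound : ∀ v : ℝ → ℝ, Measurable v →
      (∫⁻ t in Set.Ioi (0:ℝ),
          (∫⁻ s in Set.Ioc (0:ℝ) t, ENNReal.ofReal |v s|) ^ q
            * ENNReal.ofReal (h t)) ^ (1 / q)
        ≤ ENNReal.ofReal C *
          (∫⁻ t in Set.Ioi (0:ℝ),
            ENNReal.ofReal |v t| ^ p * ENNReal.ofReal (ω t)) ^ (1 / p)) :
    (Bp0 p ω ∧ (∫⁻ t in Set.Ioi (1:ℝ), ENNReal.ofReal (h t)) < ⊤) ∧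
    (∀ u u' : ℝ → ℝ, MemD p ω u u' → Tendsto u (𝓝[>] 0) (𝓝 0) →
      (∫⁻ t in Set.Ioi (0:ℝ),
          ENNReal.ofReal |u t| ^ q * ENNReal.ofReal (h t)) ^ (1 / q)
        ≤ ENNReal.ofReal C *
          (∫⁻ t in Set.Ioi (0:ℝ),
            ENNReal.ofReal |u' t| ^ p * ENNReal.ofReal (ω t)) ^ (1 / p)) ∧
    ((∫⁻ t in Set.Ioc (0:ℝ) 1, ENNReal.ofReal (h t)) = ⊤ →
      ∀ u u' : ℝ → ℝ, MemD p ω u u' → ∀ c : ℝ,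
        Tendsto u (𝓝[>] 0) (𝓝 c) → c ≠ 0 →
        (∫⁻ t in Set.Ioi (0:ℝ),
          ENNReal.ofReal |u t| ^ q * ENNReal.ofReal (h t)) = ⊤) := by
  have hp0 : 0 < p := by linarith
  have hq0 : 0 < q := by linarith
  have htail : ∀ a : ℝ, 0 < a → ∫⁻ t in Ioi a, ENNReal.ofReal (h t) < ⊤ := by
    intro a ha
    have hA0 := hω.lintegral_rpow_pos (-1 / (p - 1)) (half_pos ha) (half_lt_self ha)
    have hA1 := hω.lintegral_rpow_lt_top (-1 / (p - 1)) (half_pos ha) (a := a)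
    have hT := hardy_test hp hq hω hmeas hbound (half_pos ha) (half_lt_self ha)
    by_contra hcon
    rw [not_lt_top_iff.1 hcon, ENNReal.top_rpow_of_pos (by positivity),
      ENNReal.mul_top hA0.ne', top_le_iff] at hT
    exact ENNReal.mul_ne_top ENNReal.ofReal_ne_top
      (ENNReal.rpow_ne_top_of_nonneg (by positivity) hA1.ne) hT
  refine ⟨⟨?_, htail 1 one_pos⟩, ?_, ?_⟩
  · set H := ∫⁻ t in Ioi (1 : ℝ), ENNReal.ofReal (h t) with hH
    have hH0 : H ≠ 0 := by
      intro h0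
      rw [hH, lintegral_eq_zero_iff hmeas.ennreal_ofReal] at h0
      have hpos' := ae_restrict_of_ae_restrict_of_subset (Ioi_subset_Ioi zero_le_one) hpos
      have hF : ∀ᵐ t ∂(volume.restrict (Ioi (1 : ℝ))), False := by
        filter_upwards [h0, hpos'] with t h1 h2
        exact (ENNReal.ofReal_pos.2 h2).ne' h1
      rw [ae_iff] at hF
      simp at hF
    have hHq : H ^ (1 / q) ≠ 0 := by
      simp [ENNReal.rpow_eq_zero_iff, hH0, hq0, hq0.not_gt]
    have hs : 0 < 1 - 1 / p := by
      rw [sub_pos, div_lt_one hp0]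
      exact hp
    set B := (ENNReal.ofReal C / H ^ (1 / q)) ^ (1 / (1 - 1 / p)) with hB
    have hBtop : B < ⊤ := ENNReal.rpow_lt_top_of_nonneg (by positivity)
      (ENNReal.div_ne_top ENNReal.ofReal_ne_top hHq)
    have hle : ∀ ε : ℝ, 0 < ε → ε < 1 →
        ∫⁻ t in Ioc ε 1, ENNReal.ofReal (ω t ^ (-1 / (p - 1))) ≤ B := by
      intro ε hε hε1
      have hT := hardy_test hp hq hω hmeas hbound hε hε1
      have hA0 := hω.lintegral_rpow_pos (-1 / (p - 1)) hε hε1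
      have hA1 := hω.lintegral_rpow_lt_top (-1 / (p - 1)) hε (a := 1)
      set A := ∫⁻ t in Ioc ε 1, ENNReal.ofReal (ω t ^ (-1 / (p - 1)))
      have hsplit : A = A ^ (1 / p) * A ^ (1 - 1 / p) := by
        rw [← ENNReal.rpow_add _ _ hA0.ne' hA1.ne, add_sub_cancel, ENNReal.rpow_one]
      have hApow0 : A ^ (1 / p) ≠ 0 := (ENNReal.rpow_pos hA0 hA1.ne).ne'
      have hApow1 : A ^ (1 / p) ≠ ⊤ := ENNReal.rpow_ne_top_of_nonneg (by positivity) hA1.ne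
      nth_rewrite 1 [hsplit] at hT
      rw [mul_assoc, mul_comm (ENNReal.ofReal C), ENNReal.mul_le_mul_iff_right hApow0 hApow1] at hT
      rw [hB, one_div (1 - 1 / p), ENNReal.le_rpow_inv_iff hs]
      exact (ENNReal.le_div_iff_mul_le (Or.inl hHq) (Or.inr ENNReal.ofReal_ne_top)).2 hT
    have hU : Ioc (0 : ℝ) 1 = ⋃ n : ℕ, Ioc (1 / ((n : ℝ) + 2)) 1 := by
      ext x
      simp only [mem_iUnion, mem_Ioc, exists_and_right, and_congr_left_iff]
      refine fun _ => ⟨fun hx => ?_, fun ⟨n, hn⟩ => lt_trans (by positivity) hn⟩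
      obtain ⟨n, hn⟩ := exists_nat_one_div_lt hx
      refine ⟨n, lt_of_le_of_lt ?_ hn⟩
      gcongr
      norm_num
    have hmono : Monotone fun n : ℕ => Ioc (1 / ((n : ℝ) + 2)) (1 : ℝ) := by
      intro m n hmn
      refine Ioc_subset_Ioc_left ?_
      gcongr
    have hfin : ∫⁻ t in Ioc (0 : ℝ) 1, ENNReal.ofReal (ω t ^ (-1 / (p - 1))) < ⊤ := by
      rw [hU, setLIntegral_iUnion_of_directed _ hmono.directed_le]
      refine lt_of_le_of_lt (iSup_le fun n => hle _ (by positivity) ?_) hBtop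
      rw [div_lt_one (by positivity)]
      linarith [n.cast_nonneg (α := ℝ)]
    have hc : ContinuousOn (fun t => ω t ^ (-1 / (p - 1))) (Ioc 0 1) :=
      (hω.1.rpow_const fun x hx => Or.inl (hω.2 x hx).ne').mono fun x hx => hx.1
    refine ⟨hc.aestronglyMeasurable measurableSet_Ioc, ?_⟩
    rw [hasFiniteIntegral_iff_ofReal]
    · exact hfin
    · exact (ae_restrict_mem measurableSet_Ioc).mono fun t ht =>
        Real.rpow_nonneg (hω.2 t ht.1).le _
  · intro u u' hu h0
    have hae := hu.aemeasurable
    have hB := hbound _ hae.measurable_mk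
    have heq := hae.ae_eq_mk
    have hR : ∫⁻ t in Ioi 0, ENNReal.ofReal |hae.mk u' t| ^ p * ENNReal.ofReal (ω t)
        = ∫⁻ t in Ioi 0, ENNReal.ofReal |u' t| ^ p * ENNReal.ofReal (ω t) :=
      lintegral_congr_ae (heq.mono fun t ht => by simp only [ht])
    rw [hR] at hB
    refine le_trans (ENNReal.rpow_le_rpow (setLIntegral_mono' measurableSet_Ioi fun t ht => ?_)
      (by positivity)) hB
    gcongr
    refine (hu.ofReal_abs_le h0 ht).trans_eq (lintegral_congr_ae ?_)
    filter_upwards [ae_restrict_of_ae_restrict_of_subset Ioc_subset_Ioi_self heq] with s hs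
    rw [hs]
  · intro htop u u' _ c hc hc0
    have hc2 : |c| / 2 < |c| := half_lt_self (abs_pos.2 hc0)
    obtain ⟨δ, hδ, hδu⟩ := mem_nhdsGT_iff_exists_Ioc_subset.1 (hc.abs.eventually_const_lt hc2)
    have hδ0 : (0 : ℝ) < δ := hδ
    have hnear : ∫⁻ t in Ioc 0 δ, ENNReal.ofReal (h t) = ⊤ := by
      by_contra hcon
      have hsub : Ioc (0 : ℝ) 1 ⊆ Ioc 0 δ ∪ Ioi δ := fun x hx =>
        (le_or_gt x δ).imp (fun hle => ⟨hx.1, hle⟩) id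
      have hlt := ((lintegral_mono_set hsub).trans (lintegral_union_le _ _ _)).trans_lt
        (ENNReal.add_lt_top.2 ⟨Ne.lt_top hcon, htail δ hδ0⟩)
      exact hlt.ne htop
    have hpow : ENNReal.ofReal (|c| / 2) ^ q ≠ 0 :=
      (ENNReal.rpow_pos (ENNReal.ofReal_pos.2 (half_pos (abs_pos.2 hc0)))
        ENNReal.ofReal_ne_top).ne'
    rw [← top_le_iff, ← ENNReal.mul_top hpow, ← hnear,
      ← lintegral_const_mul _ hmeas.ennreal_ofReal]
    refine le_trans (setLIntegral_mono' measurableSet_Ioc fun t ht => ?_)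
      (lintegral_mono_set Ioc_subset_Ioi_self)
    gcongr
    exact le_of_lt (hδu ht)

end
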